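/- Let R be a simple, nonelementary Cu-semiring satisfying (O5). Then R is almost unperforated, and R is almost divisible: for every a ∈ R, every k ≥ 1, and every a' ∈ R with a' ≪ a, there exists x ∈ R with k·x ≤ a and a' ≤ (k+1)·x. -/

import Mathlib

open scoped ENNReal

/-- The (sequential) way-below relation: `a ≪ b` if for every increasing
sequence `f` with a supremum `s` such that `b ≤ s`, some `f n` dominates `a`. -/
def CuWayBelow {S : Type*} [Preorder S] (a b : S) : Prop :=
  ∀ f : ℕ → S, Monotone f → ∀ s : S, IsLUB (Set.range f) s → b ≤ s → ∃ n : ℕ, a ≤ f n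

/-- An abstract Cu-semigroup: a positively ordered monoid satisfying the
axioms (O1)-(O4). -/
structure IsCuSemigroup (S : Type*) [AddCommMonoid S] [PartialOrder S] : Prop where
  /-- addition is order-preserving -/
  add_le_add : ∀ a b c : S, a ≤ b → a + c ≤ b + c
  /-- `0` is the least element -/
  zero_le : ∀ a : S, 0 ≤ a
  /-- (O1) every increasing sequence has a supremum -/
  O1 : ∀ f : ℕ → S, Monotone f → ∃ s : S, IsLUB (Set.range f) s
  /-- (O2) every element is the supremum of a rapidly increasing sequence -/
  O2 : ∀ a : S, ∃ f : ℕ → S, (∀ n : ℕ, CuWayBelow (f n) (f (n + 1))) ∧ IsLUB (Set.range f) a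
  /-- (O3) way-below is additive -/
  O3 : ∀ a' a b' b : S, CuWayBelow a' a → CuWayBelow b' b → CuWayBelow (a' + b') (a + b)
  /-- (O4) suprema of increasing sequences are additive -/
  O4 : ∀ f g : ℕ → S, Monotone f → Monotone g → ∀ s t : S, IsLUB (Set.range f) s →
    IsLUB (Set.range g) t → IsLUB (Set.range (fun n => f n + g n)) (s + t)

/-- An ideal of a Cu-semigroup: an order-hereditary submonoid closed under
suprema of increasing sequences. -/
structure IsCuIdeal {S : Type*} [AddCommMonoid S] [PartialOrder S] (I : Set S) : Prop where
  zero_mem : (0 : S) ∈ I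
  add_mem : ∀ a b : S, a ∈ I → b ∈ I → a + b ∈ I
  mem_of_le : ∀ a b : S, a ≤ b → b ∈ I → a ∈ I
  lub_mem : ∀ f : ℕ → S, Monotone f → (∀ n : ℕ, f n ∈ I) → ∀ s : S, IsLUB (Set.range f) s → s ∈ I

/-- A Cu-semigroup is simple if its only ideals are `{0}` and the whole
semigroup. -/
def CuSimple (S : Type*) [AddCommMonoid S] [PartialOrder S] : Prop :=
  ∀ I : Set S, IsCuIdeal I → I = {0} ∨ I = Set.univ

/-- Axiom (O5): almost algebraic order. -/
def CuO5 (S : Type*) [AddCommMonoid S] [PartialOrder S] : Prop :=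
  ∀ a' a b' b c : S, a + b ≤ c → CuWayBelow a' a → CuWayBelow b' b →
    ∃ x : S, a' + x ≤ c ∧ c ≤ a + x ∧ b' ≤ x

/-- Axiom (O6): almost Riesz decomposition. -/
def CuO6 (S : Type*) [AddCommMonoid S] [PartialOrder S] : Prop :=
  ∀ a' a b c : S, CuWayBelow a' a → a ≤ b + c →
    ∃ e f : S, a' ≤ e + f ∧ e ≤ a ∧ e ≤ b ∧ f ≤ a ∧ f ≤ c

/-- Weak cancellation: `a + x ≪ b + x` implies `a ≪ b`. -/
def CuWeaklyCancellative (S : Type*) [AddCommMonoid S] [PartialOrder S] : Prop :=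
  ∀ a b x : S, CuWayBelow (a + x) (b + x) → CuWayBelow a b

section WayBelow

variable {S : Type*}

theorem CuWayBelow.le [Preorder S] {a b : S} (h : CuWayBelow a b) : a ≤ b := by
  obtain ⟨_, hn⟩ := h (fun _ => b) monotone_const b (by simp) le_rfl
  exact hn

theorem CuWayBelow.trans_le [Preorder S] {a b c : S} (h : CuWayBelow a b) (hbc : b ≤ c) :
    CuWayBelow a c :=
  fun f hf s hs hcs => h f hf s hs (hbc.trans hcs)

theorem CuWayBelow.of_le [Preorder S] {a b c : S} (hab : a ≤ b) (h : CuWayBelow b c) :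
    CuWayBelow a c := fun f hf s hs hcs =>
  let ⟨n, hn⟩ := h f hf s hs hcs
  ⟨n, hab.trans hn⟩

variable [AddCommMonoid S] [PartialOrder S]

theorem IsCuSemigroup.zero_wayBelow (hS : IsCuSemigroup S) (a : S) : CuWayBelow 0 a :=
  fun _ _ _ _ _ => ⟨0, hS.zero_le _⟩

theorem IsCuSemigroup.exists_between (hS : IsCuSemigroup S) {a b : S} (h : CuWayBelow a b) :
    ∃ c, CuWayBelow a c ∧ CuWayBelow c b := by
  obtain ⟨f, hf, hb⟩ := hS.O2 b
  obtain ⟨n, hn⟩ := h f (monotone_nat_of_le_succ fun n => (hf n).le) b hb le_rfl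
  exact ⟨f (n + 1), .of_le hn (hf n), (hf (n + 1)).trans_le (hb.1 ⟨n + 2, rfl⟩)⟩

/-- A way-below pair can be filled by an infinite rapidly increasing sequence. -/
theorem IsCuSemigroup.exists_chain (hS : IsCuSemigroup S) {a b : S} (h : CuWayBelow a b) :
    ∃ f : ℕ → S, f 0 = a ∧ (∀ n, CuWayBelow (f n) (f (n + 1))) ∧ ∀ n, CuWayBelow (f n) b := by
  choose g hg using fun c : {c : S // CuWayBelow c b} => hS.exists_between c.2
  let F : ℕ → {c : S // CuWayBelow c b} := fun n =>
    Nat.rec ⟨a, h⟩ (fun _ c => ⟨g c, (hg c).2⟩) n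
  exact ⟨fun n => (F n).1, rfl, fun n => (hg (F n)).1, fun n => (F n).2⟩

theorem IsCuSemigroup.exists_ne_zero_wayBelow (hS : IsCuSemigroup S) {a : S} (ha : a ≠ 0) :
    ∃ b, b ≠ 0 ∧ CuWayBelow b a := by
  obtain ⟨f, hf, hs⟩ := hS.O2 a
  by_contra! H
  refine ha (le_antisymm (hs.2 ?_) (hS.zero_le a))
  rintro _ ⟨n, rfl⟩
  by_contra hn
  exact H (f n) (fun h0 => hn h0.le) ((hf n).trans_le (hs.1 ⟨n + 1, rfl⟩))

theorem IsCuSemigroup.isOrderedAddMonoid (hS : IsCuSemigroup S) : IsOrderedAddMonoid S where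
  add_le_add_left a b h c := hS.add_le_add a b c h

/-- In a simple Cu-semigroup, every element way below another one is dominated by a multiple of any
given nonzero element. -/
theorem CuSimple.exists_le_nsmul (hsimple : CuSimple S) (hS : IsCuSemigroup S) {a c d : S}
    (ha : a ≠ 0) (hcd : CuWayBelow c d) : ∃ n : ℕ, c ≤ n • a := by
  have := hS.isOrderedAddMonoid
  have hmono : Monotone fun n : ℕ => n • a :=
    fun m n h => nsmul_le_nsmul_left (hS.zero_le a) h
  obtain ⟨e, he⟩ := hS.O1 _ hmono
  have hee : e + e ≤ e := by
    refine (hS.O4 _ _ hmono hmono e e he he).2 ?_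
    rintro _ ⟨n, rfl⟩
    exact he.1 ⟨n + n, add_nsmul a n n⟩
  have hI : IsCuIdeal {b | b ≤ e} :=
    { zero_mem := hS.zero_le e
      add_mem := fun x y hx hy => (add_le_add hx hy).trans hee
      mem_of_le := fun x y hxy hy => le_trans hxy hy
      lub_mem := fun f _ hf s hs => hs.2 (by rintro _ ⟨n, rfl⟩; exact hf n) }
  rcases hsimple _ hI with h | h
  · have : a ∈ ({0} : Set S) := h ▸ he.1 ⟨1, one_nsmul a⟩
    exact absurd this ha
  · exact hcd _ hmono e he (h.symm ▸ Set.mem_univ d : d ∈ {b | b ≤ e})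

theorem IsCuSemigroup.sum_wayBelow (hS : IsCuSemigroup S) {f g : ℕ → S}
    (h : ∀ n, CuWayBelow (f n) (g n)) (L : ℕ) :
    CuWayBelow (∑ i ∈ Finset.range L, f i) (∑ i ∈ Finset.range L, g i) := by
  induction L with
  | zero => exact hS.zero_wayBelow _
  | succ n ih =>
    rw [Finset.sum_range_succ, Finset.sum_range_succ]
    exact hS.O3 _ _ _ _ ih (h n)

theorem IsCuSemigroup.nsmul_wayBelow (hS : IsCuSemigroup S) {a b : S} (h : CuWayBelow a b)
    (k : ℕ) : CuWayBelow (k • a) (k • b) := by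
  simpa using hS.sum_wayBelow (fun _ => h) k

end WayBelow

section Semiring

variable {R : Type*} [CommSemiring R] [PartialOrder R]

theorem IsCuSemigroup.isOrderedRing (hR : IsCuSemigroup R)
    (hmul_mono : ∀ a b c : R, a ≤ b → c * a ≤ c * b) : IsOrderedRing R where
  add_le_add_left a b h c := hR.add_le_add a b c h
  zero_le_one := hR.zero_le 1
  mul_le_mul_of_nonneg_left a _ b c h := hmul_mono b c a h
  mul_le_mul_of_nonneg_right a _ b c h := by
    simpa only [mul_comm a] using hmul_mono b c a h

/-- The product of nonzero elements in a simple Cu-semiring is nonzero. -/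
theorem CuSimple.noZeroDivisors (hsimple : CuSimple R) (hR : IsCuSemigroup R)
    (hmul_mono : ∀ a b c : R, a ≤ b → c * a ≤ c * b)
    (hmul_lub : ∀ f g : ℕ → R, Monotone f → Monotone g → ∀ s t : R,
      IsLUB (Set.range f) s → IsLUB (Set.range g) t →
      IsLUB (Set.range (fun n => f n * g n)) (s * t)) : NoZeroDivisors R where
  eq_zero_or_eq_zero_of_mul_eq_zero {a b} hab := by
    have hI : IsCuIdeal {c : R | a * c = 0} :=
      { zero_mem := mul_zero a
        add_mem := fun x y hx hy => by
          simp only [Set.mem_ofPred_eq] at *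
          rw [mul_add, hx, hy, add_zero]
        mem_of_le := fun x y hxy hy => by
          simp only [Set.mem_ofPred_eq] at *
          exact le_antisymm (hy ▸ hmul_mono x y a hxy) (hR.zero_le _)
        lub_mem := fun f hf hf0 s hs => by
          have h := hmul_lub (fun _ => a) f monotone_const hf a s (by simp) hs
          refine le_antisymm (h.2 ?_) (hR.zero_le _)
          rintro _ ⟨n, rfl⟩
          exact (hf0 n).le }
    rcases hsimple _ hI with h | h
    · have : b ∈ ({0} : Set R) := h ▸ hab
      exact Or.inr this
    · have : (1 : R) ∈ {c : R | a * c = 0} := h.symm ▸ Set.mem_univ _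
      exact Or.inl (by simpa using this)

/-- A unit that is not minimal dominates twice a nonzero element. -/
theorem CuO5.exists_two_mul_le_one [IsOrderedRing R] [NoZeroDivisors R] (hO5 : CuO5 R)
    (hR : IsCuSemigroup R) {b : R} (hb0 : b ≠ 0) (hb1 : b ≤ 1) (hb : b ≠ 1) :
    ∃ s : R, s ≠ 0 ∧ 2 * s ≤ 1 := by
  obtain ⟨b', hb'0, hb'⟩ := hR.exists_ne_zero_wayBelow hb0
  obtain ⟨x, hx1, hx2, -⟩ := hO5 b' b 0 0 1 (by simpa using hb1) hb' (hR.zero_wayBelow 0)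
  have hx0 : x ≠ 0 := by
    rintro rfl
    exact hb (le_antisymm hb1 (by simpa using hx2))
  refine ⟨b' * x, mul_ne_zero hb'0 hx0, ?_⟩
  have h0 : 0 ≤ b' ^ 2 + x ^ 2 := hR.zero_le _
  calc 2 * (b' * x) ≤ 2 * (b' * x) + (b' ^ 2 + x ^ 2) := le_add_of_nonneg_right h0
    _ = (b' + x) ^ 2 := by ring
    _ ≤ 1 := pow_le_one₀ (hR.zero_le _) hx1

/-- There are arbitrarily small way-below pairs of uniformly bounded ratio. -/
theorem exists_small_wayBelow_pair [IsOrderedRing R] [NoZeroDivisors R]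
    (hR : IsCuSemigroup R)
    (hmul_wb : ∀ a' a b' b : R, CuWayBelow a' a → CuWayBelow b' b →
      CuWayBelow (a' * b') (a * b))
    (hsimple : CuSimple R) {s : R} (hs0 : s ≠ 0) (hs : 2 * s ≤ 1) :
    ∃ Q : ℕ, ∀ M : ℕ, ∃ t' t : R, t' ≠ 0 ∧ CuWayBelow t' t ∧ t ≤ Q * t' ∧ M * t ≤ 1 := by
  have : Nontrivial R := ⟨s, 0, hs0⟩
  obtain ⟨r, hr0, hr⟩ := hR.exists_ne_zero_wayBelow hs0
  obtain ⟨q, hq0, hq⟩ := hR.exists_ne_zero_wayBelow hr0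
  obtain ⟨Q, hQ⟩ := hsimple.exists_le_nsmul hR hq0 hr
  obtain ⟨f, hf0, hf, hfr⟩ := hR.exists_chain hq
  have hfmono : Monotone f := monotone_nat_of_le_succ fun n => (hf n).le
  have hfne : ∀ n, f n ≠ 0 := fun n h0 =>
    hq0 (le_antisymm (by simpa [hf0, h0] using hfmono (Nat.zero_le n)) (hR.zero_le q))
  have key : ∀ n : ℕ, CuWayBelow (∏ i ∈ Finset.range (n + 1), f i)
      (∏ i ∈ Finset.range (n + 1), f (i + 1)) ∧
      2 ^ (n + 1) * ∏ i ∈ Finset.range (n + 1), f (i + 1) ≤ 1 := by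
    have hstep : ∀ n, 2 * f (n + 1) ≤ 1 := fun n => by
      refine le_trans ?_ hs
      gcongr
      exact (hfr _).le.trans hr.le
    intro n
    induction n with
    | zero => simpa using ⟨hf 0, hstep 0⟩
    | succ n ih =>
      rw [Finset.prod_range_succ, Finset.prod_range_succ (fun i => f (i + 1))]
      refine ⟨hmul_wb _ _ _ _ ih.1 (hf _), ?_⟩
      calc _ = (2 ^ (n + 1) * ∏ i ∈ Finset.range (n + 1), f (i + 1)) * (2 * f (n + 1 + 1)) := by
            ring
        _ ≤ 1 := mul_le_one₀ ih.2 (hR.zero_le _) (hstep _)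
  refine ⟨Q, fun M => ⟨∏ i ∈ Finset.range (M + 1), f i, ∏ i ∈ Finset.range (M + 1), f (i + 1),
    Finset.prod_ne_zero_iff.2 fun i _ => hfne i, (key M).1, ?_, ?_⟩⟩
  · rw [Finset.prod_range_succ, Finset.prod_range_succ' f, mul_left_comm, hf0,
      ← nsmul_eq_mul Q q]
    gcongr
    · exact hR.zero_le _
    · exact (hfr _).le.trans hQ
  · refine le_trans ?_ (key M).2
    have h : M ≤ 2 ^ (M + 1) :=
      Nat.lt_two_pow_self.le.trans (Nat.pow_le_pow_right two_pos (by simp))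
    have h' : (M : R) ≤ 2 ^ (M + 1) := by exact_mod_cast Nat.mono_cast (α := R) h
    gcongr
    exact hR.zero_le _

/-- There is a nonzero `y` such that `K * y` is way below some `B ≤ 1` with `B ≤ (K + 1) * y`. -/
theorem exists_tight_wayBelow_pair [IsOrderedRing R] (hR : IsCuSemigroup R) (K : ℕ)
    (H : ∃ Q : ℕ, ∀ M : ℕ, ∃ t' t : R, t' ≠ 0 ∧ CuWayBelow t' t ∧ t ≤ Q * t' ∧ M * t ≤ 1) :
    ∃ y B : R, y ≠ 0 ∧ CuWayBelow (K * y) B ∧ B ≤ (K + 1) * y ∧ B ≤ 1 := by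
  obtain ⟨Q, hQ⟩ := H
  obtain ⟨t', t, ht'0, htt, htQ, htM⟩ := hQ (K * (K * Q + 1))
  obtain ⟨f, hf0, hf, hft⟩ := hR.exists_chain htt
  have hfmono : Monotone f := monotone_nat_of_le_succ fun n => (hf n).le
  set L := K * Q + 1 with hL
  have hLy : (L : R) * t' ≤ ∑ i ∈ Finset.range L, f i := by
    rw [← nsmul_eq_mul]
    simpa using Finset.card_nsmul_le_sum (Finset.range L) f t'
      (fun i _ => hf0 ▸ hfmono (Nat.zero_le i))
  have ht'L : t' ≤ ∑ i ∈ Finset.range L, f i := by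
    refine le_trans ?_ hLy
    rw [hL]
    push_cast
    rw [add_mul, one_mul]
    exact le_add_of_nonneg_left (hR.zero_le _)
  have hsucc : ∑ i ∈ Finset.range L, f (i + 1) ≤ ∑ i ∈ Finset.range L, f i + t := by
    calc _ ≤ ∑ i ∈ Finset.range L, f (i + 1) + f 0 := le_add_of_nonneg_right (hR.zero_le _)
      _ = ∑ i ∈ Finset.range L, f i + f L := by
        rw [← Finset.sum_range_succ', Finset.sum_range_succ]
      _ ≤ _ := by gcongr; exact (hft L).le
  refine ⟨∑ i ∈ Finset.range L, f i, K * ∑ i ∈ Finset.range L, f (i + 1), ?_, ?_, ?_, ?_⟩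
  · intro h0
    exact ht'0 (le_antisymm (h0 ▸ ht'L) (hR.zero_le _))
  · simpa [nsmul_eq_mul] using hR.nsmul_wayBelow (hR.sum_wayBelow hf L) K
  · calc _ ≤ (K : R) * (∑ i ∈ Finset.range L, f i + t) := by gcongr
      _ ≤ K * (∑ i ∈ Finset.range L, f i + Q * t') := by gcongr
      _ ≤ K * (∑ i ∈ Finset.range L, f i + Q * t') + t' := le_add_of_nonneg_right (hR.zero_le _)
      _ = K * ∑ i ∈ Finset.range L, f i + L * t' := by rw [hL]; push_cast; ring
      _ ≤ K * ∑ i ∈ Finset.range L, f i + ∑ i ∈ Finset.range L, f i := by gcongr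
      _ = _ := by ring
  · refine le_trans ?_ htM
    have h : ∑ i ∈ Finset.range L, f (i + 1) ≤ L * t := by
      rw [← nsmul_eq_mul]
      simpa using Finset.sum_le_card_nsmul (Finset.range L) (fun i => f (i + 1)) t
        (fun i _ => (hft _).le)
    calc _ ≤ (K : R) * (L * t) := by gcongr
      _ = _ := by push_cast; ring

/-- Expanding the products of `b i + x i ≤ 1` and of `b (i + 1) + x i ≥ 1` and telescoping. -/
theorem exists_telescoping_expansion [IsOrderedRing R] (h0 : ∀ a : R, 0 ≤ a) {c : R} {b x : ℕ → R}
    (hc : ∀ n, c ≤ b n) (hb : ∀ n, b n ≤ b (n + 1)) (hle : ∀ n, b n + x n ≤ 1)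
    (hge : ∀ n, 1 ≤ b (n + 1) + x n) (n : ℕ) :
    ∃ ρ W : R, 1 ≤ ρ + b n * W ∧ c * W + ρ ≤ 1 ∧ n * ρ ≤ W := by
  induction n with
  | zero => exact ⟨1, 0, by simp, by simp, by simp⟩
  | succ n ih =>
    obtain ⟨ρ, W, h1, h2, h3⟩ := ih
    have hx : x n ≤ 1 := le_trans (le_add_of_nonneg_left (h0 _)) (hle n)
    have hρ := h0 ρ
    have hW := h0 W
    have hxn := h0 (x n)
    have hbn := h0 (b n)
    refine ⟨ρ * x n, ρ + (b n + x n) * W, ?_, ?_, ?_⟩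
    · calc 1 ≤ (ρ + b n * W) * (b (n + 1) + x n) := by
            simpa using mul_le_mul h1 (hge n) (h0 1) (h0 _)
        _ = ρ * x n + (b (n + 1) * (ρ + b n * W) + b n * (x n * W)) := by ring
        _ ≤ ρ * x n + (b (n + 1) * (ρ + b n * W) + b (n + 1) * (x n * W)) := by
            gcongr; exact hb n
        _ = _ := by ring
    · calc _ = c * ρ + ρ * x n + (b n + x n) * (c * W) := by ring
        _ ≤ b n * ρ + ρ * x n + (b n + x n) * (c * W) := by gcongr; exact hc n
        _ = (b n + x n) * (c * W + ρ) := by ring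
        _ ≤ 1 := mul_le_one₀ (hle n) (h0 _) h2
    · calc _ = ρ * x n + x n * (n * ρ) := by push_cast; ring
        _ ≤ ρ * 1 + x n * W := by gcongr
        _ ≤ ρ * 1 + x n * W + b n * W := le_add_of_nonneg_right (h0 _)
        _ = _ := by ring

/-- The unit is almost divisible as soon as there are tight way-below pairs. -/
theorem exists_almost_divisor_one [IsOrderedRing R] (hR : IsCuSemigroup R) (hsimple : CuSimple R)
    (hO5 : CuO5 R) {K : ℕ} {y B u : R} (hy : y ≠ 0) (hyB : CuWayBelow (K * y) B)
    (hBy : B ≤ (K + 1) * y) (hB : B ≤ 1) (hu : CuWayBelow u 1) :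
    ∃ z : R, K * z ≤ 1 ∧ u ≤ (K + 2) * z := by
  obtain ⟨b, hb0, hb, hbB⟩ := hR.exists_chain hyB
  have hbmono : Monotone b := monotone_nat_of_le_succ fun n => (hb n).le
  choose x hx1 hx2 _ using fun n => hO5 (b n) (b (n + 1)) 0 0 1
    (by simpa using (hbB _).le.trans hB) (hb n) (hR.zero_wayBelow 0)
  obtain ⟨n, hn⟩ := hsimple.exists_le_nsmul hR hy hu
  rw [nsmul_eq_mul] at hn
  obtain ⟨ρ, W, h1, h2, h3⟩ := exists_telescoping_expansion hR.zero_le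
    (fun n => hb0 ▸ hbmono (Nat.zero_le n)) (fun n => (hb n).le) hx1 hx2 n
  have hρ := hR.zero_le ρ
  have hW := hR.zero_le W
  have hy0 := hR.zero_le y
  have hu0 := hR.zero_le u
  refine ⟨y * W, ?_, ?_⟩
  · rw [← mul_assoc]
    exact (le_add_of_nonneg_right hρ).trans h2
  · calc u ≤ u * (ρ + b n * W) := by simpa using mul_le_mul_of_nonneg_left h1 hu0
      _ ≤ u * (ρ + (K + 1) * y * W) := by gcongr; exact (hbB n).le.trans hBy
      _ = u * ρ + u * ((K + 1) * y * W) := by ring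
      _ ≤ (n * y) * ρ + 1 * ((K + 1) * y * W) := by
          gcongr
          · exact hR.zero_le _
          · exact hu.le
      _ = y * (n * ρ) + (K + 1) * y * W := by ring
      _ ≤ y * W + (K + 1) * y * W := by gcongr
      _ = _ := by ring

/-- The unit of a simple nonelementary Cu-semiring satisfying (O5) is almost divisible. -/
theorem one_almost_divisible [IsOrderedRing R]
    (hR : IsCuSemigroup R)
    (hmul_lub : ∀ f g : ℕ → R, Monotone f → Monotone g → ∀ s t : R,
      IsLUB (Set.range f) s → IsLUB (Set.range g) t →
      IsLUB (Set.range (fun n => f n * g n)) (s * t))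
    (hmul_wb : ∀ a' a b' b : R, CuWayBelow a' a → CuWayBelow b' b →
      CuWayBelow (a' * b') (a * b))
    (hsimple : CuSimple R)
    (hnonelem : (∃ a : R, a ≠ 0) ∧ ¬ ∃ a : R, a ≠ 0 ∧ ∀ b : R, b ≠ 0 → b ≤ a → b = a)
    (hO5 : CuO5 R) (k : ℕ) {u : R} (hu : CuWayBelow u 1) :
    ∃ z : R, k * z ≤ 1 ∧ u ≤ (k + 1) * z := by
  obtain ⟨⟨a, ha⟩, hmin⟩ := hnonelem
  have : NoZeroDivisors R := hsimple.noZeroDivisors hR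
    (fun a b c h => mul_le_mul_of_nonneg_left h (hR.zero_le c)) hmul_lub
  have h1 : (1 : R) ≠ 0 := fun h => ha (by rw [← one_mul a, h, zero_mul])
  push Not at hmin
  obtain ⟨b, hb0, hb1, hb⟩ := hmin 1 h1
  obtain ⟨s, hs0, hs⟩ := hO5.exists_two_mul_le_one hR hb0 hb1 hb
  obtain ⟨y, B, hy, hyB, hBy, hB⟩ := exists_tight_wayBelow_pair hR (2 * k)
    (exists_small_wayBelow_pair hR hmul_wb hsimple hs0 hs)
  obtain ⟨z, hz1, hz2⟩ := exists_almost_divisor_one hR hsimple hO5 hy hyB hBy hB hu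
  refine ⟨2 * z, ?_, ?_⟩
  · convert hz1 using 1
    push_cast
    ring
  · convert hz2 using 1
    push_cast
    ring

end Semiring

/-- Let `R` be a simple, nonelementary Cu-semiring (a
Cu-semigroup with a commutative unital multiplication which is a
Cu-bimorphism) satisfying (O5).  Then `R` is almost unperforated and almost
divisible. -/
theorem stmt19 {R : Type*} [CommSemiring R] [PartialOrder R]
    (hR : IsCuSemigroup R)
    (hmul_mono : ∀ a b c : R, a ≤ b → c * a ≤ c * b)
    (hmul_lub : ∀ f g : ℕ → R, Monotone f → Monotone g → ∀ s t : R,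
      IsLUB (Set.range f) s → IsLUB (Set.range g) t →
      IsLUB (Set.range (fun n => f n * g n)) (s * t))
    (hmul_wb : ∀ a' a b' b : R, CuWayBelow a' a → CuWayBelow b' b →
      CuWayBelow (a' * b') (a * b))
    (hsimple : CuSimple R)
    (hnonelem : (∃ a : R, a ≠ 0) ∧ ¬ ∃ a : R, a ≠ 0 ∧ ∀ b : R, b ≠ 0 → b ≤ a → b = a)
    (hO5 : CuO5 R) :
    (∀ a b : R, (∃ k : ℕ, (k + 1) • a ≤ k • b) → a ≤ b) ∧
    (∀ a : R, ∀ k : ℕ, 1 ≤ k → ∀ a' : R, CuWayBelow a' a →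
      ∃ x : R, k • x ≤ a ∧ a' ≤ (k + 1) • x) := by
  have := hR.isOrderedRing hmul_mono
  have hdiv : ∀ k : ℕ, ∀ u : R, CuWayBelow u 1 → ∃ z : R, k * z ≤ 1 ∧ u ≤ (k + 1) * z :=
    fun k u hu => one_almost_divisible hR hmul_lub hmul_wb hsimple hnonelem hO5 k hu
  obtain ⟨f, hf, hf1⟩ := hR.O2 1
  have hfwb : ∀ n, CuWayBelow (f n) 1 := fun n => (hf n).trans_le (hf1.1 ⟨n + 1, rfl⟩)
  have hlub : ∀ a : R, IsLUB (Set.range fun n => a * f n) a := fun a => by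
    simpa using hmul_lub (fun _ => a) f monotone_const
      (monotone_nat_of_le_succ fun n => (hf n).le) a 1 (by simp) hf1
  constructor
  · rintro a b ⟨k, hk⟩
    simp only [nsmul_eq_mul, Nat.cast_add, Nat.cast_one] at hk
    refine (hlub a).2 ?_
    rintro _ ⟨n, rfl⟩
    obtain ⟨z, hz1, hz2⟩ := hdiv k (f n) (hfwb n)
    calc a * f n ≤ a * ((k + 1) * z) := hmul_mono _ _ _ hz2
      _ = z * ((k + 1) * a) := by ring
      _ ≤ z * (k * b) := hmul_mono _ _ _ hk
      _ = b * (k * z) := by ring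
      _ ≤ b * 1 := hmul_mono _ _ _ hz1
      _ = b := mul_one b
  · intro a k _ a' ha'
    have hmono : Monotone fun n => a * f n :=
      monotone_nat_of_le_succ fun n => hmul_mono _ _ _ (hf n).le
    obtain ⟨n, hn⟩ := ha' _ hmono a (hlub a) le_rfl
    obtain ⟨z, hz1, hz2⟩ := hdiv k (f n) (hfwb n)
    simp only [nsmul_eq_mul, Nat.cast_add, Nat.cast_one]
    refine ⟨a * z, ?_, ?_⟩
    · calc (k : R) * (a * z) = a * (k * z) := by ring
        _ ≤ a * 1 := hmul_mono _ _ _ hz1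
        _ = a := mul_one a
    · calc a' ≤ a * f n := hn
        _ ≤ a * ((k + 1) * z) := hmul_mono _ _ _ hz2
        _ = (k + 1) * (a * z) := by ring
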